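/- The Valknut linking is not combinatorially isotopic (for any ordering of the triangles) to any linking consisting of a Hopf linking of two triangles together with a third triangle whose convex hull is disjoint from the outlines of the first two triangles. -/

import Mathlib

open scoped Matrix

noncomputable section

/-- A point of 3-space. -/
abbrev Pt : Type := Fin 3 → ℝ

/-- A (non-degenerate) triangle in 3-space, given by three affinely independent vertices. -/
structure Tri where
  A : Pt
  B : Pt
  C : Pt
  indep : AffineIndependent ℝ ![A, B, C]

namespace Tri

/-- The set of vertices of a triangle. -/
def vertexSet (T : Tri) : Set Pt := {T.A, T.B, T.C}

/-- The outline `∂T` of a triangle: the union of the three closed edges. -/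
def outline (T : Tri) : Set Pt :=
  segment ℝ T.A T.B ∪ segment ℝ T.B T.C ∪ segment ℝ T.C T.A

/-- The convex hull `⟨T⟩` of a triangle. -/
def hull (T : Tri) : Set Pt := convexHull ℝ {T.A, T.B, T.C}

end Tri

/-- A family of triangles is a linking if the outlines are pairwise disjoint. -/
def IsLinking {ι : Type*} (T : ι → Tri) : Prop :=
  ∀ i j, i ≠ j → Disjoint (T i).outline (T j).outline

/-- An elementary move replaces one triangle `ABC` of the family by `ABC'`, where `C'` is a
point not on the line `AB` such that `(⟨A,C,C'⟩ ∪ ⟨B,C,C'⟩) ∩ ∂XYZ = ∅` for every other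
triangle `XYZ` of the family. -/
def ElemMove {ι : Type*} (T T' : ι → Tri) : Prop :=
  ∃ (i : ι) (A B C C' : Pt),
    (T i).vertexSet = {A, B, C} ∧
    (T' i).vertexSet = {A, B, C'} ∧
    C' ∉ affineSpan ℝ ({A, B} : Set Pt) ∧
    ∀ j, j ≠ i →
      (convexHull ℝ ({A, C, C'} : Set Pt) ∪ convexHull ℝ ({B, C, C'} : Set Pt))
          ∩ (T j).outline = ∅ ∧
      T' j = T j

/-- Two families of triangles are combinatorially isotopic if one can be obtained from the
other by a finite sequence of elementary moves. -/
def CombIsotopic {ι : Type*} (T T' : ι → Tri) : Prop :=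
  Relation.ReflTransGen ElemMove T T'

/-- The cyclic coordinate permutation `σ(a,b,c) = (c,a,b)`. -/
def cyc (v : Pt) : Pt := ![v 2, v 0, v 1]

def w₁ : Pt := ![1, 0, 0]
def w₂ : Pt := ![-2 / Real.sqrt 5, 1 / Real.sqrt 10, 0]
def w₃ : Pt := ![-2 / Real.sqrt 5, -1 / Real.sqrt 10, 0]

/-- `T` is the Valknut linking: the first triangle has vertices `(1,0,0)`,
`(-2/√5, ±1/√10, 0)`, and each subsequent triangle is the image of the previous one under
the cyclic coordinate permutation. -/
def IsValknut (T : Fin 3 → Tri) : Prop :=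
  (T 0).vertexSet = {w₁, w₂, w₃} ∧
  (T 1).vertexSet = {cyc w₁, cyc w₂, cyc w₃} ∧
  (T 2).vertexSet = {cyc (cyc w₁), cyc (cyc w₂), cyc (cyc w₃)}

/-- The union of all segments joining points of `V`. -/
def skel (V : Set Pt) : Set Pt := ⋃ a ∈ V, ⋃ b ∈ V, segment ℝ a b

lemma mem_skel {V : Set Pt} {x : Pt} : x ∈ skel V ↔ ∃ a ∈ V, ∃ b ∈ V, x ∈ segment ℝ a b := by
  simp [skel]

lemma subset_skel (V : Set Pt) : V ⊆ skel V := fun a ha =>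
  mem_skel.2 ⟨a, ha, a, ha, left_mem_segment ℝ a a⟩

lemma skel_subset_of_convex {V S : Set Pt} (hS : Convex ℝ S) (h : V ⊆ S) : skel V ⊆ S := by
  intro x hx
  obtain ⟨a, ha, b, hb, hx⟩ := mem_skel.1 hx
  exact hS.segment_subset (h ha) (h hb) hx

lemma outline_eq_skel (T : Tri) : T.outline = skel T.vertexSet := by
  ext x
  rw [mem_skel]
  simp only [Tri.outline, Tri.vertexSet, Set.mem_union]
  constructor
  · rintro ((h | h) | h)
    · exact ⟨T.A, by simp, T.B, by simp, h⟩
    · exact ⟨T.B, by simp, T.C, by simp, h⟩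
    · exact ⟨T.C, by simp, T.A, by simp, h⟩
  · rintro ⟨a, ha, b, hb, h⟩
    have h' := h
    rw [segment_symm] at h'
    rcases ha with rfl | rfl | rfl <;> rcases hb with rfl | rfl | rfl
    · simp only [segment_same, Set.mem_singleton_iff] at h
      subst h; exact Or.inl (Or.inl (left_mem_segment ℝ _ _))
    · exact Or.inl (Or.inl h)
    · exact Or.inr h'
    · exact Or.inl (Or.inl h')
    · simp only [segment_same, Set.mem_singleton_iff] at h
      subst h; exact Or.inl (Or.inl (right_mem_segment ℝ _ _))
    · exact Or.inl (Or.inr h)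
    · exact Or.inr h
    · exact Or.inl (Or.inr h')
    · simp only [segment_same, Set.mem_singleton_iff] at h
      subst h; exact Or.inr (left_mem_segment ℝ _ _)

lemma isCompact_segment' (a b : Pt) : IsCompact (segment ℝ a b) := by
  rw [segment_eq_image_lineMap]
  exact isCompact_Icc.image AffineMap.lineMap_continuous

lemma isCompact_skel {V : Set Pt} (hV : V.Finite) : IsCompact (skel V) :=
  hV.isCompact_biUnion fun a _ => hV.isCompact_biUnion fun b _ => isCompact_segment' a b

lemma image_skel (L : Pt →ᵃ[ℝ] Pt) (V : Set Pt) : L '' skel V = skel (L '' V) := by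
  simp only [skel, Set.image_iUnion, image_segment, Set.biUnion_image]

lemma not_collinear_of_tri (T : Tri) {A B C : Pt} (h : T.vertexSet = {A, B, C}) :
    ¬ Collinear ℝ ({A, B, C} : Set Pt) := by
  rw [← h]
  exact affineIndependent_iff_not_collinear_set.1 T.indep

lemma exists_functional {A B C : Pt} (hC : ¬ Collinear ℝ ({A, B, C} : Set Pt)) :
    ∃ f : Pt →L[ℝ] ℝ, f (B - A) = 0 ∧ f (C - A) = 1 := by
  have hn : C - A ∉ Submodule.span ℝ {B - A} := by
    intro hm
    apply hC
    obtain ⟨r, hr⟩ := Submodule.mem_span_singleton.1 hm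
    have : C ∈ affineSpan ℝ ({A, B} : Set Pt) := by
      have h1 : C = AffineMap.lineMap A B r := by
        rw [AffineMap.lineMap_apply, vsub_eq_sub, vadd_eq_add, hr]; abel
      rw [h1]; exact AffineMap.lineMap_mem_affineSpan_pair r A B
    have h2 := collinear_insert_of_mem_affineSpan_pair this
    have h3 : ({C, A, B} : Set Pt) = {A, B, C} := by ext; simp; tauto
    rwa [h3] at h2
  obtain ⟨f, hf1, hf2⟩ := Submodule.exists_le_ker_of_notMem hn
  have h0 : f (B - A) = 0 := hf2 (Submodule.mem_span_singleton_self _)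
  refine ⟨LinearMap.toContinuousLinearMap ((f (C - A))⁻¹ • f), ?_, ?_⟩
  · simp only [LinearMap.coe_toContinuousLinearMap', LinearMap.smul_apply, h0, smul_zero]
  · simp only [LinearMap.coe_toContinuousLinearMap', LinearMap.smul_apply, smul_eq_mul]
    exact inv_mul_cancel₀ hf1

lemma local_move {A B C : Pt} (hC : ¬ Collinear ℝ ({A, B, C} : Set Pt)) {K : Set Pt}
    (hK : IsClosed K) (hd : Disjoint (skel {A, B, C}) K) :
    ∃ ε > 0, ∀ C', dist C' C < ε → ∃ h : Pt ≃ₜ Pt,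
      h '' skel {A, B, C} = skel {A, B, C'} ∧ ∀ x ∈ K, h x = x := by
  obtain ⟨f, hf1, hf2⟩ := exists_functional hC
  set S := skel {A, B, C} with hS
  have hSc : IsCompact S := isCompact_skel (by simp)
  have hSne : S.Nonempty := ⟨A, subset_skel _ (by simp)⟩
  obtain ⟨δ, hδ, hth⟩ := hd.exists_thickenings hSc hK
  have hfar : ∀ x ∈ K, δ ≤ Metric.infDist x S := by
    intro x hx
    by_contra! hlt
    exact Set.disjoint_left.1 hth
      ((Metric.mem_thickening_iff_infDist_lt hSne).2 hlt) (Metric.self_subset_thickening hδ _ hx)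
  have hl : ∀ x ∈ S, 0 ≤ f (x - A) ∧ f (x - A) ≤ 1 := by
    have hconv : Convex ℝ {x : Pt | 0 ≤ f (x - A) ∧ f (x - A) ≤ 1} := by
      have : {x : Pt | 0 ≤ f (x - A) ∧ f (x - A) ≤ 1} = f ⁻¹' (Set.Icc (f A) (1 + f A)) := by
        ext x
        simp only [map_sub, Set.mem_ofPred_eq, Set.mem_preimage, Set.mem_Icc]
        constructor <;> rintro ⟨h1, h2⟩ <;> constructor <;> linarith
      rw [this]
      exact (convex_Icc _ _).linear_preimage f.toLinearMap
    apply skel_subset_of_convex hconv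
    rintro x (rfl | rfl | rfl)
    · simp
    · show 0 ≤ f _ ∧ f _ ≤ 1
      rw [hf1]; norm_num
    · show 0 ≤ f _ ∧ f _ ≤ 1
      rw [hf2]; norm_num
  let φ : Pt → ℝ := fun x => max 0 (min (f (x - A)) (1 - δ⁻¹ * Metric.infDist x S))
  obtain ⟨c, hφ⟩ : ∃ c, LipschitzWith c φ := by
    have h1 : LipschitzWith (‖f‖₊ * 1) (fun x => f (x - A)) :=
      f.lipschitz.comp (LipschitzWith.of_dist_le' (K := 1) (by intro x y; simp))
        |>.weaken (by simp)
    have h2 : LipschitzWith (0 + ‖δ⁻¹‖₊ * 1) (fun x => 1 - δ⁻¹ * Metric.infDist x S) :=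
      (LipschitzWith.const (1 : ℝ)).sub
        ((lipschitzWith_smul (δ⁻¹)).comp (Metric.lipschitz_infDist_pt S))
    exact ⟨_, (LipschitzWith.const (0 : ℝ)).max (h1.min h2)⟩
  refine ⟨((c : ℝ) + 1)⁻¹, by positivity, fun C' hC' => ?_⟩
  set w := C' - C with hw
  have hwn : (c : ℝ) * ‖w‖ < 1 := by
    rw [dist_eq_norm, ← hw] at hC'
    have : ((c : ℝ) + 1) * ‖w‖ < 1 := by
      have := mul_lt_mul_of_pos_left hC' (show (0 : ℝ) < c + 1 by positivity)
      rwa [mul_inv_cancel₀ (by positivity)] at this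
    nlinarith [norm_nonneg w]
  have happ : ApproximatesLinearOn (fun x => x + φ x • w)
      ((ContinuousLinearEquiv.refl ℝ Pt : Pt ≃L[ℝ] Pt) : Pt →L[ℝ] Pt) Set.univ (c * ‖w‖₊) := by
    rw [ApproximatesLinearOn]
    intro x _ y _
    have : x + φ x • w - (y + φ y • w)
        - ((ContinuousLinearEquiv.refl ℝ Pt : Pt ≃L[ℝ] Pt) : Pt →L[ℝ] Pt) (x - y)
        = (φ x - φ y) • w := by
      simp only [ContinuousLinearEquiv.coe_refl, ContinuousLinearMap.coe_id', id_eq, sub_smul]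
      abel
    rw [this, norm_smul]
    have h3 := hφ.dist_le_mul x y
    rw [dist_eq_norm, dist_eq_norm] at h3
    push_cast
    calc ‖φ x - φ y‖ * ‖w‖ ≤ (c * ‖x - y‖) * ‖w‖ := by gcongr
      _ = _ := by ring
  have hlt : c * ‖w‖₊ < ‖(((ContinuousLinearEquiv.refl ℝ Pt).symm : Pt ≃L[ℝ] Pt) :
      Pt →L[ℝ] Pt)‖₊⁻¹ := by
    have : ‖(((ContinuousLinearEquiv.refl ℝ Pt).symm : Pt ≃L[ℝ] Pt) : Pt →L[ℝ] Pt)‖₊ = 1 := by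
      rw [ContinuousLinearEquiv.refl_symm, ContinuousLinearEquiv.coe_refl]
      exact ContinuousLinearMap.nnnorm_id
    rw [this, inv_one]
    exact_mod_cast hwn
  refine ⟨happ.toHomeomorph (fun x => x + φ x • w) (Or.inr hlt), ?_, ?_⟩
  · let L : Pt →ᵃ[ℝ] Pt := AffineMap.id ℝ Pt +
      ((f.toLinearMap.smulRight w).toAffineMap - AffineMap.const ℝ Pt (f A • w))
    have hL : ∀ x, L x = x + f (x - A) • w := by
      intro x; simp [L, sub_smul]
    have h1 : (happ.toHomeomorph (fun x => x + φ x • w) (Or.inr hlt)) '' S = L '' S := by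
      apply Set.image_congr
      intro x hx
      change x + φ x • w = L x
      rw [hL]
      have : φ x = f (x - A) := by
        simp only [φ, Metric.infDist_zero_of_mem hx, mul_zero, sub_zero]
        rw [min_eq_left (hl x hx).2, max_eq_right (hl x hx).1]
      rw [this]
    rw [h1, hS, image_skel, Set.image_insert_eq, Set.image_insert_eq, Set.image_singleton]
    have e1 : L A = A := by rw [hL]; simp
    have e2 : L B = B := by rw [hL, hf1]; simp
    have e3 : L C = C' := by rw [hL, hf2, hw]; simp
    rw [e1, e2, e3]
  · intro x hx
    change x + φ x • w = x
    have : φ x = 0 := by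
      apply max_eq_left
      apply (min_le_right _ _).trans
      have := hfar x hx
      have h4 : 1 ≤ δ⁻¹ * Metric.infDist x S := by
        rw [inv_mul_eq_div, le_div_iff₀ hδ]; linarith
      linarith
    rw [this]; simp

/-- The triangles `ABC` and `ABC'` are related by a homeomorphism fixing `K`. -/
def MoveRel (A B : Pt) (K : Set Pt) (C C' : Pt) : Prop :=
  ∃ h : Pt ≃ₜ Pt, h '' skel {A, B, C} = skel {A, B, C'} ∧ ∀ x ∈ K, h x = x

lemma MoveRel.symm {A B : Pt} {K : Set Pt} {C C' : Pt} (h : MoveRel A B K C C') :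
    MoveRel A B K C' C := by
  obtain ⟨h, h1, h2⟩ := h
  refine ⟨h.symm, ?_, ?_⟩
  · rw [← h1, ← Set.image_comp]; simp
  · intro x hx
    rw [Homeomorph.symm_apply_eq]; exact (h2 x hx).symm

lemma MoveRel.trans {A B : Pt} {K : Set Pt} {C C' C'' : Pt} (h : MoveRel A B K C C')
    (h' : MoveRel A B K C' C'') : MoveRel A B K C C'' := by
  obtain ⟨h, h1, h2⟩ := h
  obtain ⟨g, g1, g2⟩ := h'
  refine ⟨h.trans g, ?_, ?_⟩
  · rw [← g1, ← h1, ← Set.image_comp]; rfl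
  · intro x hx
    simp [h2 x hx, g2 x hx]

lemma seg_move {A B C C' : Pt} {K : Set Pt} (hK : IsClosed K)
    (h : ∀ X ∈ segment ℝ C C', ¬ Collinear ℝ ({A, B, X} : Set Pt) ∧
      Disjoint (skel {A, B, X}) K) : MoveRel A B K C C' := by
  refine (convex_segment C C').isPreconnected.induction₂ (MoveRel A B K) ?_ ?_ ?_
    (left_mem_segment ℝ C C') (right_mem_segment ℝ C C')
  · intro X hX
    obtain ⟨ε, hε, hm⟩ := local_move (h X hX).1 hK (h X hX).2
    apply mem_nhdsWithin_of_mem_nhds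
    filter_upwards [Metric.ball_mem_nhds X hε] with Y hY
    exact hm Y hY
  · intro x y z _ _ _ h1 h2
    exact h1.trans h2
  · intro x y _ _ h1
    exact h1.symm

lemma skel_near {A B X X' : Pt} {W : Set Pt} {δ : ℝ} (hδ : 0 < δ) (h : skel {A, B, X} ⊆ W)
    (hX : dist X' X < δ) : skel {A, B, X'} ⊆ Metric.thickening δ W := by
  intro x hx
  obtain ⟨a', ha', b', hb', s, t, hs, ht, hst, rfl⟩ := mem_skel.1 hx
  have key : ∀ a' ∈ ({A, B, X'} : Set Pt), ∃ a ∈ ({A, B, X} : Set Pt),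
      a' - a ∈ Metric.ball (0 : Pt) δ := by
    rintro a' (rfl | rfl | rfl)
    · exact ⟨a', by simp, by simpa using hδ⟩
    · exact ⟨a', by simp, by simpa using hδ⟩
    · exact ⟨X, by simp, by rw [mem_ball_zero_iff, ← dist_eq_norm]; exact hX⟩
  obtain ⟨a, ha, had⟩ := key a' ha'
  obtain ⟨b, hb, hbd⟩ := key b' hb'
  rw [Metric.mem_thickening_iff]
  refine ⟨s • a + t • b, h (mem_skel.2 ⟨a, ha, b, hb, s, t, hs, ht, hst, rfl⟩), ?_⟩
  have := (convex_ball (0 : Pt) δ) had hbd hs ht hst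
  rw [mem_ball_zero_iff] at this
  rw [dist_eq_norm]
  have e : s • a' + t • b' - (s • a + t • b) = s • (a' - a) + t • (b' - b) := by
    rw [smul_sub, smul_sub]; abel
  rw [e]; exact this

lemma collinear_iff' {A B : Pt} (hAB : A ≠ B) (X : Pt) :
    Collinear ℝ ({A, B, X} : Set Pt) ↔ ∃ r : ℝ, X = A + r • (B - A) := by
  constructor
  · intro h
    have : X ∈ affineSpan ℝ ({A, B} : Set Pt) :=
      h.mem_affineSpan_of_mem_of_ne (by simp) (by simp) (by simp) hAB
    obtain ⟨r, rfl⟩ := mem_affineSpan_pair_iff_exists_lineMap_eq.1 this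
    exact ⟨r, by rw [AffineMap.lineMap_apply, vsub_eq_sub, vadd_eq_add, add_comm]⟩
  · rintro ⟨r, rfl⟩
    have : A + r • (B - A) ∈ affineSpan ℝ ({A, B} : Set Pt) := by
      have := AffineMap.lineMap_mem_affineSpan_pair r A B
      rwa [AffineMap.lineMap_apply, vsub_eq_sub, vadd_eq_add, add_comm] at this
    have h2 := collinear_insert_of_mem_affineSpan_pair this
    have h3 : ({A + r • (B - A), A, B} : Set Pt) = {A, B, A + r • (B - A)} := by
      ext; simp; tauto
    rwa [h3] at h2

lemma exists_transverse (u v : Pt) {δ : ℝ} (hδ : 0 < δ) :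
    ∃ n : Pt, n ∉ Submodule.span ℝ ({u, v} : Set Pt) ∧ ‖n‖ < δ := by
  have hne : Submodule.span ℝ ({u, v} : Set Pt) ≠ ⊤ := by
    intro h
    have h1 : Module.finrank ℝ (Submodule.span ℝ ({u, v} : Set Pt)) ≤ 2 := by
      have := finrank_span_finset_le_card (R := ℝ) ({u, v} : Finset Pt)
      have h2 := Finset.card_le_two (a := u) (b := v)
      rw [Set.finrank, Finset.coe_pair] at this
      omega
    rw [h, finrank_top] at h1
    simp at h1
  obtain ⟨n, -, hn⟩ := SetLike.exists_of_lt (lt_top_iff_ne_top.2 hne)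
  have hp : 0 < ‖n‖ + 1 := by positivity
  refine ⟨(δ / (‖n‖ + 1)) • n, ?_, ?_⟩
  · intro h
    exact hn ((Submodule.smul_mem_iff _ (by positivity)).1 h)
  · rw [norm_smul, Real.norm_of_nonneg (by positivity), div_mul_eq_mul_div, div_lt_iff₀ hp]
    nlinarith

lemma elem_move {A B C C' : Pt} {K : Set Pt} (hK : IsClosed K)
    (hC : ¬ Collinear ℝ ({A, B, C} : Set Pt)) (hC' : ¬ Collinear ℝ ({A, B, C'} : Set Pt))
    (h0 : Disjoint (skel {A, B, C}) K)
    (h1 : Disjoint (convexHull ℝ ({A, C, C'} : Set Pt) ∪ convexHull ℝ ({B, C, C'} : Set Pt)) K) :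
    MoveRel A B K C C' := by
  have hAB : A ≠ B := by
    rintro rfl
    apply hC
    simpa using collinear_pair ℝ A C
  set W : Set Pt := skel {A, B, C} ∪
    (convexHull ℝ ({A, C, C'} : Set Pt) ∪ convexHull ℝ ({B, C, C'} : Set Pt)) with hW
  have hWc : IsCompact W := (isCompact_skel (by simp)).union
    ((Set.Finite.isCompact_convexHull ℝ (Set.toFinite _)).union
      (Set.Finite.isCompact_convexHull ℝ (Set.toFinite _)))
  have hWK : Disjoint W K := Set.disjoint_union_left.2 ⟨h0, h1⟩
  have hsub : ∀ X ∈ segment ℝ C C', skel {A, B, X} ⊆ W := by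
    intro X hX x hx
    have hXA : X ∈ convexHull ℝ ({A, C, C'} : Set Pt) :=
      (convex_convexHull ℝ _).segment_subset (subset_convexHull ℝ _ (by simp))
        (subset_convexHull ℝ _ (by simp)) hX
    have hXB : X ∈ convexHull ℝ ({B, C, C'} : Set Pt) :=
      (convex_convexHull ℝ _).segment_subset (subset_convexHull ℝ _ (by simp))
        (subset_convexHull ℝ _ (by simp)) hX
    have hA : A ∈ convexHull ℝ ({A, C, C'} : Set Pt) := subset_convexHull ℝ _ (by simp)
    have hB : B ∈ convexHull ℝ ({B, C, C'} : Set Pt) := subset_convexHull ℝ _ (by simp)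
    have cA := convex_convexHull ℝ ({A, C, C'} : Set Pt)
    have cB := convex_convexHull ℝ ({B, C, C'} : Set Pt)
    obtain ⟨a, ha, b, hb, hseg⟩ := mem_skel.1 hx
    clear hx
    rcases ha with rfl | rfl | rfl <;> rcases hb with rfl | rfl | rfl
    · exact Or.inl (mem_skel.2 ⟨_, by simp, _, by simp, hseg⟩)
    · exact Or.inl (mem_skel.2 ⟨a, by simp, b, by simp, hseg⟩)
    · exact Or.inr (Or.inl (cA.segment_subset hA hXA hseg))
    · exact Or.inl (mem_skel.2 ⟨a, by simp, b, by simp, hseg⟩)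
    · exact Or.inl (mem_skel.2 ⟨_, by simp, _, by simp, hseg⟩)
    · exact Or.inr (Or.inr (cB.segment_subset hB hXB hseg))
    · exact Or.inr (Or.inl (cA.segment_subset hXA hA hseg))
    · exact Or.inr (Or.inr (cB.segment_subset hXB hB hseg))
    · exact Or.inr (Or.inl (cA.segment_subset hXA hXA hseg))
  by_cases hgood : ∀ X ∈ segment ℝ C C', ¬ Collinear ℝ ({A, B, X} : Set Pt)
  · exact seg_move hK fun X hX => ⟨hgood X hX, hWK.mono_left (hsub X hX)⟩
  push Not at hgood
  obtain ⟨X0, hX0, hcol⟩ := hgood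
  obtain ⟨δ, hδ, hth⟩ := hWK.exists_thickenings hWc hK
  obtain ⟨n, hn, hnδ⟩ := exists_transverse (B - A) (C - A) hδ
  set P := Submodule.span ℝ ({B - A, C - A} : Set Pt) with hP
  have hBP : B - A ∈ P := Submodule.subset_span (by simp)
  have hCP : C - A ∈ P := Submodule.subset_span (by simp)
  have hC'P : C' - A ∈ P := by
    obtain ⟨r, hr⟩ := (collinear_iff' hAB X0).1 hcol
    obtain ⟨s, t, hs, ht, hst, hX⟩ := hX0
    have ht0 : t ≠ 0 := by
      rintro rfl
      apply hC
      have : s = 1 := by linarith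
      rw [this] at hX
      simp only [one_smul, zero_smul, add_zero] at hX
      rwa [hX]
    have h2 : t • (C' - A) = r • (B - A) - s • (C - A) := by
      have h3 : s • C + t • C' = (s + t) • A + r • (B - A) := by rw [hX, hst, one_smul, hr]
      have h4 : t • C' = (s + t) • A + r • (B - A) - s • C := by rw [← h3]; abel
      rw [smul_sub, smul_sub s, h4, add_smul]; abel
    rw [← Submodule.smul_mem_iff _ ht0, h2]
    exact P.sub_mem (P.smul_mem _ hBP) (P.smul_mem _ hCP)
  have key : ∀ Y ∈ segment ℝ C C', ∀ s : ℝ, 0 ≤ s → s ≤ 1 →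
      (s = 0 → ¬ Collinear ℝ ({A, B, Y} : Set Pt)) →
      ¬ Collinear ℝ ({A, B, Y + s • n} : Set Pt) ∧ Disjoint (skel {A, B, Y + s • n}) K := by
    intro Y hY s hs0 hs1 hsY
    constructor
    · intro hc
      by_cases hs : s = 0
      · apply hsY hs
        rwa [hs, zero_smul, add_zero] at hc
      · obtain ⟨r, hr⟩ := (collinear_iff' hAB _).1 hc
        apply hn
        have hYP : Y - A ∈ P := by
          obtain ⟨p, q, hp, hq, hpq, rfl⟩ := hY
          have : p • C + q • C' - A = p • (C - A) + q • (C' - A) := by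
            have : A = (p + q) • A := by rw [hpq, one_smul]
            conv_lhs => rw [this]
            rw [add_smul, smul_sub, smul_sub]; abel
          rw [this]
          exact P.add_mem (P.smul_mem _ hCP) (P.smul_mem _ hC'P)
        rw [← Submodule.smul_mem_iff _ hs]
        have : s • n = r • (B - A) - (Y - A) := by
          have : s • n = (Y + s • n) - Y := by abel
          rw [this, hr]; abel
        rw [this]
        exact P.sub_mem (P.smul_mem _ hBP) hYP
    · have hlt : dist (Y + s • n) Y < δ := by
        rw [dist_eq_norm, add_sub_cancel_left, norm_smul, Real.norm_of_nonneg hs0]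
        nlinarith [norm_nonneg n]
      exact hth.mono (skel_near hδ (hsub Y hY) hlt) (Metric.self_subset_thickening hδ K)
  have m1 : MoveRel A B K C (C + n) := by
    apply seg_move hK
    intro X hX
    rw [segment_eq_image'] at hX
    obtain ⟨s, ⟨hs0, hs1⟩, rfl⟩ := hX
    have := key C (left_mem_segment ℝ _ _) s hs0 hs1 (fun _ => hC)
    simpa using this
  have m2 : MoveRel A B K (C + n) (C' + n) := by
    apply seg_move hK
    intro X hX
    rw [segment_eq_image'] at hX
    obtain ⟨s, hs, rfl⟩ := hX
    have := key (C + s • (C' - C)) (by rw [segment_eq_image']; exact ⟨s, hs, rfl⟩) 1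
      (by norm_num) le_rfl (fun h => absurd h one_ne_zero)
    have e : C + n + s • (C' + n - (C + n)) = C + s • (C' - C) + (1 : ℝ) • n := by
      rw [one_smul, add_sub_add_right_eq_sub]; abel
    simp only [e]
    exact this
  have m3 : MoveRel A B K C' (C' + n) := by
    apply seg_move hK
    intro X hX
    rw [segment_eq_image'] at hX
    obtain ⟨s, ⟨hs0, hs1⟩, rfl⟩ := hX
    have := key C' (right_mem_segment ℝ _ _) s hs0 hs1 (fun _ => hC')
    simpa using this
  exact m1.trans (m2.trans m3.symm)

lemma elemMove_homeo {T T' : Fin 3 → Tri} (hT : IsLinking T) (hm : ElemMove T T') :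
    ∃ h : Pt ≃ₜ Pt, ∀ i, h '' (T i).outline = (T' i).outline := by
  obtain ⟨i, A, B, C, C', hi, hi', -, hj⟩ := hm
  have hcl : IsClosed (⋃ j ∈ ({i}ᶜ : Set (Fin 3)), (T j).outline) := by
    apply (Set.toFinite _).isClosed_biUnion
    intro j _
    rw [outline_eq_skel]
    exact (isCompact_skel (by simp [Tri.vertexSet])).isClosed
  obtain ⟨h, h1, h2⟩ := elem_move (K := ⋃ j ∈ ({i}ᶜ : Set (Fin 3)), (T j).outline) hcl
    (not_collinear_of_tri _ hi) (not_collinear_of_tri _ hi')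
    (by
      rw [← hi, ← outline_eq_skel, Set.disjoint_iUnion₂_right]
      intro j hji
      exact hT i j (Ne.symm hji))
    (by
      rw [Set.disjoint_iUnion₂_right]
      intro j hji
      exact Set.disjoint_iff_inter_eq_empty.2 (hj j hji).1)
  refine ⟨h, fun j => ?_⟩
  by_cases hji : j = i
  · subst hji
    rw [outline_eq_skel, outline_eq_skel, hi, hi', h1]
  · rw [(hj j hji).2]
    have : h '' (T j).outline = id '' (T j).outline := by
      apply Set.image_congr
      intro x hx
      exact h2 x (Set.mem_biUnion (show j ∈ ({i}ᶜ : Set (Fin 3)) from hji) hx)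
    rw [this, Set.image_id]

lemma isotopic_homeo {T T' : Fin 3 → Tri} (hT : IsLinking T) (hm : CombIsotopic T T') :
    IsLinking T' ∧ ∃ h : Pt ≃ₜ Pt, ∀ i, h '' (T i).outline = (T' i).outline := by
  induction hm with
  | refl => exact ⟨hT, Homeomorph.refl _, fun i => by simp⟩
  | tail _ hs ih =>
    obtain ⟨hl, h, hh⟩ := ih
    obtain ⟨g, hg⟩ := elemMove_homeo hl hs
    refine ⟨?_, h.trans g, fun i => ?_⟩
    · intro i j hij
      rw [← hg i, ← hg j]
      exact (Set.disjoint_image_iff g.injective).2 (hl i j hij)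
    · rw [← hg i, ← hh i, ← Set.image_comp]; rfl

open Topology in
lemma exists_section {Y : Type} [TopologicalSpace Y] [SimplyConnectedSpace Y]
    [LocallyPathConnectedSpace Y] (U : Fin 3 → Set Y) (hU : ∀ i, IsOpen (U i))
    (hcov : ∀ y, ∃ i, y ∈ U i) (g : Fin 3 → Y → Equiv.Perm (Fin 3))
    (hg : ∀ i j y, y ∈ U i → y ∈ U j →
      ∀ᶠ y' in 𝓝 y, g j y' * (g i y')⁻¹ = g j y * (g i y)⁻¹) :
    ∃ s : Fin 3 → Y → Fin 3, (∀ i, ContinuousOn (s i) (U i)) ∧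
      ∀ i j y, y ∈ U i → y ∈ U j → s j y = (g j y * (g i y)⁻¹) (s i y) := by
  choose idx hidx using hcov
  let Z : FiberBundleCore (Fin 3) Y (Fin 3) :=
    { baseSet := U
      isOpen_baseSet := hU
      indexAt := idx
      mem_baseSet_at := hidx
      coordChange := fun i j y v => (g j y * (g i y)⁻¹) v
      coordChange_self := by intro i x _ v; simp
      continuousOn_coordChange := by
        rintro i j ⟨y, v⟩ ⟨⟨hi, hj⟩, -⟩
        apply ContinuousAt.continuousWithinAt
        have h1 : ∀ᶠ p : Y × Fin 3 in 𝓝 (y, v), g j p.1 * (g i p.1)⁻¹ = g j y * (g i y)⁻¹ :=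
          (continuous_fst.tendsto (y, v)).eventually (hg i j y hi hj)
        have h2 : ∀ᶠ p : Y × Fin 3 in 𝓝 (y, v), p.2 = v :=
          (continuous_snd.tendsto (y, v)).eventually
            (show ∀ᶠ w in 𝓝 v, w = v by rw [nhds_discrete]; exact rfl)
        refine (continuousAt_const (y := (g j y * (g i y)⁻¹) v)).congr ?_
        filter_upwards [h1, h2] with p e1 e2
        rw [e1, e2]
      coordChange_comp := by intro i j k x _ v; simp }
  have hcovm : IsCoveringMap (Bundle.TotalSpace.proj : Z.TotalSpace → Y) :=
    FiberBundle.isCoveringMap (F := Fin 3) (E := Z.Fiber)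
  obtain ⟨y0⟩ : Nonempty Y := inferInstance
  obtain ⟨F, ⟨-, hF⟩, -⟩ := hcovm.existsUnique_continuousMap_lifts (ContinuousMap.id Y) y0
    (⟨y0, (0 : Fin 3)⟩ : Z.TotalSpace) rfl
  have hF' : ∀ y, (F y).1 = y := fun y => congrFun hF y
  refine ⟨fun i y => (Z.localTriv i (F y)).2, ?_, ?_⟩
  · intro i
    apply continuous_snd.comp_continuousOn
    apply (Z.localTriv i).continuousOn.comp F.continuous.continuousOn
    intro y hy
    rw [FiberBundleCore.mem_localTriv_source, hF', ← FiberBundleCore.baseSet_at]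
    exact hy
  · intro i j y hi hj
    simp only [FiberBundleCore.localTriv_apply]
    rw [hF']
    change (g j y * (g (idx y) y)⁻¹) _ = (g j y * (g i y)⁻¹) ((g i y * (g (idx y) y)⁻¹) _)
    have key : ∀ (α β γ : Equiv.Perm (Fin 3)) (v : Fin 3),
        (α * γ⁻¹) v = (α * β⁻¹) ((β * γ⁻¹) v) := by intros; simp
    exact key _ _ _ _

/-- First disc. -/
def D1 (a b : ℝ) : Set Pt := {p | p 2 = 0 ∧ -a ≤ p 0 ∧ (1 + a) * |p 1| ≤ b * (1 - p 0)}
/-- Complementary disc of the first. -/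
def E1 (a b : ℝ) : Set Pt := {p | p 2 = 0 ∧ (p 0 ≤ -a ∨ b * (1 - p 0) ≤ (1 + a) * |p 1|)}
/-- Second disc (through infinity). -/
def D2 (a b : ℝ) : Set Pt := {p | p 0 = 0 ∧ (p 1 ≤ -a ∨ b * (1 - p 1) ≤ (1 + a) * |p 2|)}
/-- Complementary disc of the second. -/
def E2 (a b : ℝ) : Set Pt := {p | p 0 = 0 ∧ -a ≤ p 1 ∧ (1 + a) * |p 2| ≤ b * (1 - p 1)}

/-- Vertices. -/
def V0 (a b : ℝ) : Set Pt := {![1, 0, 0], ![-a, b, 0], ![-a, -b, 0]}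
/-- Vertices. -/
def V1 (a b : ℝ) : Set Pt := {![0, 1, 0], ![0, -a, b], ![0, -a, -b]}
/-- Vertices. -/
def V2 (a b : ℝ) : Set Pt := {![0, 0, 1], ![b, 0, -a], ![-b, 0, -a]}

lemma isClosed_or' {P Q : Pt → Prop} (hP : IsClosed {x | P x}) (hQ : IsClosed {x | Q x}) :
    IsClosed {x | P x ∨ Q x} := by
  have : {x | P x ∨ Q x} = {x | P x} ∪ {x | Q x} := by ext; simp
  rw [this]; exact hP.union hQ

lemma isClosed_D1 (a b : ℝ) : IsClosed (D1 a b) := by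
  apply IsClosed.and (isClosed_eq (by fun_prop) (by fun_prop))
  exact IsClosed.and (isClosed_le (by fun_prop) (by fun_prop)) (isClosed_le (by fun_prop) (by fun_prop))
lemma isClosed_E2 (a b : ℝ) : IsClosed (E2 a b) := by
  apply IsClosed.and (isClosed_eq (by fun_prop) (by fun_prop))
  exact IsClosed.and (isClosed_le (by fun_prop) (by fun_prop)) (isClosed_le (by fun_prop) (by fun_prop))
lemma isClosed_E1 (a b : ℝ) : IsClosed (E1 a b) := by
  apply IsClosed.and (isClosed_eq (by fun_prop) (by fun_prop))
  exact isClosed_or' (isClosed_le (by fun_prop) (by fun_prop))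
    (isClosed_le (by fun_prop) (by fun_prop))
lemma isClosed_D2 (a b : ℝ) : IsClosed (D2 a b) := by
  apply IsClosed.and (isClosed_eq (by fun_prop) (by fun_prop))
  exact isClosed_or' (isClosed_le (by fun_prop) (by fun_prop))
    (isClosed_le (by fun_prop) (by fun_prop))

lemma D1_D2 {a b : ℝ} (hb : 0 < b) (hab : b < a) (ha : a < 1) {p : Pt} (h1 : p ∈ D1 a b)
    (h2 : p ∈ D2 a b) : False := by
  obtain ⟨z, x, y⟩ := h1
  obtain ⟨x0, y'⟩ := h2
  rw [z, abs_zero, mul_zero] at y'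
  rw [x0] at y
  have := abs_le.1 (le_refl |p 1|)
  rcases y' with y' | y'
  · nlinarith
  · nlinarith

lemma D1_or_E1 {a b : ℝ} {p : Pt} (h : p 2 = 0) : p ∈ D1 a b ∨ p ∈ E1 a b := by
  by_cases h1 : -a ≤ p 0
  · by_cases h2 : (1 + a) * |p 1| ≤ b * (1 - p 0)
    · exact Or.inl ⟨h, h1, h2⟩
    · exact Or.inr ⟨h, Or.inr (le_of_not_ge h2)⟩
  · exact Or.inr ⟨h, Or.inl (le_of_not_ge h1)⟩

lemma D2_or_E2 {a b : ℝ} {p : Pt} (h : p 0 = 0) : p ∈ D2 a b ∨ p ∈ E2 a b := by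
  by_cases h1 : -a ≤ p 1
  · by_cases h2 : (1 + a) * |p 2| ≤ b * (1 - p 1)
    · exact Or.inr ⟨h, h1, h2⟩
    · exact Or.inl ⟨h, Or.inr (le_of_not_ge h2)⟩
  · exact Or.inl ⟨h, Or.inl (le_of_not_ge h1)⟩

/-- Planar fact: boundary points of the triangle lie on one of the three edges. -/
lemma bdry {a b : ℝ} (hb : 0 < b) (ha : 0 < a) {x y : ℝ} (h1 : -a ≤ x)
    (h2 : (1 + a) * |y| ≤ b * (1 - x)) (h3 : x ≤ -a ∨ b * (1 - x) ≤ (1 + a) * |y|) :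
    (∃ s t : ℝ, 0 ≤ s ∧ 0 ≤ t ∧ s + t = 1 ∧ x = s * (-a) + t * (-a) ∧ y = s * b + t * (-b)) ∨
    (∃ s t : ℝ, 0 ≤ s ∧ 0 ≤ t ∧ s + t = 1 ∧ x = s * 1 + t * (-a) ∧ y = t * b) ∨
    (∃ s t : ℝ, 0 ≤ s ∧ 0 ≤ t ∧ s + t = 1 ∧ x = s * 1 + t * (-a) ∧ y = t * (-b)) := by
  have h1a : (0 : ℝ) < 1 + a := by linarith
  have hx1 : x ≤ 1 := by
    have : 0 ≤ b * (1 - x) := le_trans (by positivity) h2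
    nlinarith [nonneg_of_mul_nonneg_right this hb]
  rcases h3 with h3 | h3
  · have hx : x = -a := le_antisymm h3 h1
    left
    rw [hx] at h2
    have hy : |y| ≤ b := by nlinarith
    obtain ⟨hy1, hy2⟩ := abs_le.1 hy
    refine ⟨(b + y) / (2 * b), (b - y) / (2 * b), by apply div_nonneg <;> linarith,
      by apply div_nonneg <;> linarith, by field_simp; ring, by rw [hx]; field_simp; ring,
      by field_simp; ring⟩
  · right
    have he : (1 + a) * |y| = b * (1 - x) := le_antisymm h2 h3
    rcases abs_cases y with ⟨hy, -⟩ | ⟨hy, -⟩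
    · left
      rw [hy] at he
      refine ⟨(x + a) / (1 + a), (1 - x) / (1 + a), by apply div_nonneg <;> linarith,
        by apply div_nonneg <;> linarith, by field_simp; ring, by field_simp; ring, ?_⟩
      field_simp; linarith
    · right
      rw [hy] at he
      refine ⟨(x + a) / (1 + a), (1 - x) / (1 + a), by apply div_nonneg <;> linarith,
        by apply div_nonneg <;> linarith, by field_simp; ring, by field_simp; ring, ?_⟩
      field_simp; linarith

lemma D1_E1 {a b : ℝ} (hb : 0 < b) (ha : 0 < a) {p : Pt} (h1 : p ∈ D1 a b)
    (h2 : p ∈ E1 a b) : p ∈ skel (V0 a b) := by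
  obtain ⟨z, x, y⟩ := h1
  obtain ⟨-, h3⟩ := h2
  rw [mem_skel]
  rcases bdry hb ha x y h3 with ⟨s, t, hs, ht, hst, h4, h5⟩ | ⟨s, t, hs, ht, hst, h4, h5⟩ |
    ⟨s, t, hs, ht, hst, h4, h5⟩
  · refine ⟨![-a, b, 0], by simp [V0], ![-a, -b, 0], by simp [V0], s, t, hs, ht, hst, ?_⟩
    ext i; fin_cases i <;> simp [h4, h5, z]
  · refine ⟨![1, 0, 0], by simp [V0], ![-a, b, 0], by simp [V0], s, t, hs, ht, hst, ?_⟩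
    ext i; fin_cases i <;> simp [h4, h5, z]
  · refine ⟨![1, 0, 0], by simp [V0], ![-a, -b, 0], by simp [V0], s, t, hs, ht, hst, ?_⟩
    ext i; fin_cases i <;> simp [h4, h5, z]

lemma D2_E2 {a b : ℝ} (hb : 0 < b) (ha : 0 < a) {p : Pt} (h1 : p ∈ D2 a b)
    (h2 : p ∈ E2 a b) : p ∈ skel (V1 a b) := by
  obtain ⟨z, x, y⟩ := h2
  obtain ⟨-, h3⟩ := h1
  rw [mem_skel]
  rcases bdry hb ha x y h3 with ⟨s, t, hs, ht, hst, h4, h5⟩ | ⟨s, t, hs, ht, hst, h4, h5⟩ |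
    ⟨s, t, hs, ht, hst, h4, h5⟩
  · refine ⟨![0, -a, b], by simp [V1], ![0, -a, -b], by simp [V1], s, t, hs, ht, hst, ?_⟩
    ext i; fin_cases i <;> simp [h4, h5, z]
  · refine ⟨![0, 1, 0], by simp [V1], ![0, -a, b], by simp [V1], s, t, hs, ht, hst, ?_⟩
    ext i; fin_cases i <;> simp [h4, h5, z]
  · refine ⟨![0, 1, 0], by simp [V1], ![0, -a, -b], by simp [V1], s, t, hs, ht, hst, ?_⟩
    ext i; fin_cases i <;> simp [h4, h5, z]

/-- The three charts. -/
def chart (a b : ℝ) : Fin 3 → Set Pt :=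
  ![(D1 a b ∪ D2 a b)ᶜ, (E1 a b ∪ D2 a b)ᶜ, (D1 a b ∪ E2 a b)ᶜ]

/-- The transition data. -/
def glue (i : Fin 3) (p : Pt) : Equiv.Perm (Fin 3) :=
  ![1, if 0 < p 2 then 1 else Equiv.swap 0 1, if 0 < p 0 then 1 else Equiv.swap 1 2] i

lemma isOpen_chart (a b : ℝ) (i : Fin 3) : IsOpen (chart a b i) := by
  fin_cases i
  · exact ((isClosed_D1 a b).union (isClosed_D2 a b)).isOpen_compl
  · exact ((isClosed_E1 a b).union (isClosed_D2 a b)).isOpen_compl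
  · exact ((isClosed_D1 a b).union (isClosed_E2 a b)).isOpen_compl

lemma chart_cover {a b : ℝ} (hb : 0 < b) (hab : b < a) (ha : a < 1) {p : Pt}
    (h0 : p ∉ skel (V0 a b)) (h1 : p ∉ skel (V1 a b)) : ∃ i, p ∈ chart a b i := by
  by_cases hD1 : p ∈ D1 a b
  · refine ⟨1, ?_⟩
    rintro (h | h)
    · exact h0 (D1_E1 hb (hb.trans hab) hD1 h)
    · exact D1_D2 hb hab ha hD1 h
  · by_cases hD2 : p ∈ D2 a b
    · refine ⟨2, ?_⟩
      rintro (h | h)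
      · exact hD1 h
      · exact h1 (D2_E2 hb (hb.trans hab) hD2 h)
    · exact ⟨0, by rintro (h | h) <;> contradiction⟩

open Topology in
lemma sgn_eventually {p : Pt} {k : Fin 3} (h : p k ≠ 0) :
    ∀ᶠ p' in 𝓝 p, (0 < p' k ↔ 0 < p k) := by
  have hc : ContinuousAt (fun q : Pt => q k) p :=
    (continuous_apply k).continuousAt
  rcases lt_or_gt_of_ne h with h | h
  · filter_upwards [hc.eventually (gt_mem_nhds h)] with q hq
    exact ⟨fun h' => absurd h' hq.not_gt, fun h' => absurd h' h.not_gt⟩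
  · filter_upwards [hc.eventually (lt_mem_nhds h)] with q hq
    exact ⟨fun _ => h, fun _ => hq⟩

lemma chart01 {a b : ℝ} {p : Pt} (h0 : p ∈ chart a b 0) (h1 : p ∈ chart a b 1) : p 2 ≠ 0 := by
  intro h
  rcases D1_or_E1 (a := a) (b := b) h with h | h
  · exact h0 (Or.inl h)
  · exact h1 (Or.inl h)

lemma chart02 {a b : ℝ} {p : Pt} (h0 : p ∈ chart a b 0) (h1 : p ∈ chart a b 2) : p 0 ≠ 0 := by
  intro h
  rcases D2_or_E2 (a := a) (b := b) h with h | h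
  · exact h0 (Or.inr h)
  · exact h1 (Or.inr h)

lemma chart12 {a b : ℝ} {p : Pt} (h1 : p ∈ chart a b 1) (h2 : p ∈ chart a b 2) :
    p 0 ≠ 0 ∧ p 2 ≠ 0 := by
  constructor
  · intro h
    rcases D2_or_E2 (a := a) (b := b) h with h | h
    · exact h1 (Or.inr h)
    · exact h2 (Or.inr h)
  · intro h
    rcases D1_or_E1 (a := a) (b := b) h with h | h
    · exact h2 (Or.inl h)
    · exact h1 (Or.inl h)

open Topology in
lemma trans_loc {a b : ℝ} (i j : Fin 3) {p : Pt} (hi : p ∈ chart a b i) (hj : p ∈ chart a b j) :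
    ∀ᶠ p' in 𝓝 p, glue j p' * (glue i p')⁻¹ = glue j p * (glue i p)⁻¹ := by
  have t1 : ∀ {q q' : Pt}, (0 < q 2 ↔ 0 < q' 2) → glue 1 q = glue 1 q' := by
    intro q q' h; simp [glue, h]
  have t2 : ∀ {q q' : Pt}, (0 < q 0 ↔ 0 < q' 0) → glue 2 q = glue 2 q' := by
    intro q q' h; simp [glue, h]
  have t0 : ∀ q q' : Pt, glue 0 q = glue 0 q' := fun _ _ => rfl
  fin_cases i <;> fin_cases j <;> simp only [Fin.zero_eta, Fin.mk_one, Fin.reduceFinMk] at hi hj ⊢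
  · simp
  · filter_upwards [sgn_eventually (chart01 hi hj)] with q hq
    rw [t1 hq, t0 q p]
  · filter_upwards [sgn_eventually (chart02 hi hj)] with q hq
    rw [t2 hq, t0 q p]
  · filter_upwards [sgn_eventually (chart01 hj hi)] with q hq
    rw [t1 hq, t0 q p]
  · simp
  · filter_upwards [sgn_eventually (chart12 hi hj).1, sgn_eventually (chart12 hi hj).2]
      with q hq hq'
    rw [t2 hq, t1 hq']
  · filter_upwards [sgn_eventually (chart02 hj hi)] with q hq
    rw [t2 hq, t0 q p]
  · filter_upwards [sgn_eventually (chart12 hj hi).1, sgn_eventually (chart12 hj hi).2]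
      with q hq hq'
    rw [t2 hq, t1 hq']
  · simp

lemma seg_coord {q q' x : Pt} (h : x ∈ segment ℝ q q') :
    ∃ s t : ℝ, 0 ≤ s ∧ 0 ≤ t ∧ s + t = 1 ∧ ∀ k, x k = s * q k + t * q' k := by
  obtain ⟨s, t, hs, ht, hst, rfl⟩ := h
  exact ⟨s, t, hs, ht, hst, fun k => by simp⟩

lemma swap_ne (l : Fin 3) : (Equiv.swap (0 : Fin 3) 1) ((Equiv.swap (1 : Fin 3) 2) l) ≠
    (Equiv.swap (1 : Fin 3) 2) ((Equiv.swap (0 : Fin 3) 1) l) := by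
  revert l; decide

lemma core {a b : ℝ} (hb : 0 < b) (hab : b < a) (ha : a < 1) (h : Pt ≃ₜ Pt) {H : Set Pt}
    (hH : Convex ℝ H) (h2 : ∀ p ∈ skel (V2 a b), h p ∈ H) (h0 : ∀ p ∈ skel (V0 a b), h p ∉ H)
    (h1 : ∀ p ∈ skel (V1 a b), h p ∉ H) : False := by
  let top : Pt := ![0, 0, 1]
  let pr : Pt := ![b, 0, -a]
  let pl : Pt := ![-b, 0, -a]
  let qr : Pt := ![b / 2, 0, (1 - a) / 2]
  let ql : Pt := ![-b / 2, 0, (1 - a) / 2]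
  have htop : top ∈ V2 a b := by simp [V2, top]
  have hpr : pr ∈ V2 a b := by simp [V2, pr]
  have hpl : pl ∈ V2 a b := by simp [V2, pl]
  have hqr : qr ∈ segment ℝ top pr := by
    refine ⟨1 / 2, 1 / 2, by norm_num, by norm_num, by norm_num, ?_⟩
    ext k; fin_cases k <;> simp [top, pr, qr] <;> ring
  have hql : ql ∈ segment ℝ top pl := by
    refine ⟨1 / 2, 1 / 2, by norm_num, by norm_num, by norm_num, ?_⟩
    ext k; fin_cases k <;> simp [top, pl, ql] <;> ring
  have er : segment ℝ top pr ⊆ skel (V2 a b) := fun x hx => mem_skel.2 ⟨_, htop, _, hpr, hx⟩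
  have el : segment ℝ top pl ⊆ skel (V2 a b) := fun x hx => mem_skel.2 ⟨_, htop, _, hpl, hx⟩
  have eb : segment ℝ pr pl ⊆ skel (V2 a b) := fun x hx => mem_skel.2 ⟨_, hpr, _, hpl, hx⟩
  have cr := convex_segment (𝕜 := ℝ) top pr
  have cl := convex_segment (𝕜 := ℝ) top pl
  -- the four arcs
  have Jr : segment ℝ qr pr ⊆ skel (V2 a b) :=
    (cr.segment_subset hqr (right_mem_segment ℝ _ _)).trans er
  have Jl : segment ℝ ql pl ⊆ skel (V2 a b) :=
    (cl.segment_subset hql (right_mem_segment ℝ _ _)).trans el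
  have Jt : segment ℝ top qr ∪ segment ℝ top ql ⊆ skel (V2 a b) :=
    Set.union_subset ((cr.segment_subset (left_mem_segment ℝ _ _) hqr).trans er)
      ((cl.segment_subset (left_mem_segment ℝ _ _) hql).trans el)
  have Cr : segment ℝ qr pr ⊆ chart a b 1 := by
    intro x hx
    obtain ⟨s, t, hs, ht, hst, hk⟩ := seg_coord hx
    have k0 : x 0 = s * (b / 2) + t * b := hk 0
    have k1 : x 1 = s * 0 + t * 0 := hk 1
    have k2 : x 2 = s * ((1 - a) / 2) + t * (-a) := hk 2
    have hx0 : 0 < x 0 := by rw [k0]; nlinarith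
    have hx0' : x 0 < 1 := by rw [k0]; nlinarith
    rintro (⟨-, h | h⟩ | ⟨h, -⟩)
    · linarith
    · have : x 1 = 0 := by rw [k1]; ring
      rw [this, abs_zero, mul_zero] at h
      nlinarith
    · linarith
  have Cl : segment ℝ ql pl ⊆ chart a b 1 := by
    intro x hx
    obtain ⟨s, t, hs, ht, hst, hk⟩ := seg_coord hx
    have k0 : x 0 = s * (-b / 2) + t * (-b) := hk 0
    have k1 : x 1 = s * 0 + t * 0 := hk 1
    have hx0 : x 0 < 0 := by rw [k0]; nlinarith
    have hx0' : -a < x 0 := by rw [k0]; nlinarith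
    rintro (⟨-, h | h⟩ | ⟨h, -⟩)
    · linarith
    · have : x 1 = 0 := by rw [k1]; ring
      rw [this, abs_zero, mul_zero] at h
      nlinarith
    · linarith
  have Cb : segment ℝ pr pl ⊆ chart a b 2 := by
    intro x hx
    obtain ⟨s, t, hs, ht, hst, hk⟩ := seg_coord hx
    have k1 : x 1 = s * 0 + t * 0 := hk 1
    have k2 : x 2 = s * (-a) + t * (-a) := hk 2
    have k2' : x 2 = -a := by rw [k2]; linear_combination (-a) * hst
    have k1' : x 1 = 0 := by rw [k1]; ring
    rintro (⟨h, -⟩ | ⟨-, -, h⟩)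
    · linarith
    · rw [k2', k1', abs_neg, abs_of_pos (hb.trans hab)] at h
      nlinarith
  have Ct : segment ℝ top qr ∪ segment ℝ top ql ⊆ chart a b 2 := by
    have fin : ∀ x : Pt, 0 < x 2 → x 1 = 0 → (x 0 = 0 → x 2 = 1) → x ∈ chart a b 2 := by
      rintro x h3 h4 h5 (⟨h, -⟩ | ⟨h', -, h⟩)
      · linarith
      · rw [h5 h', h4, abs_one] at h
        nlinarith
    rintro x (hx | hx)
    · obtain ⟨s, t, hs, ht, hst, hk⟩ := seg_coord hx
      have k0 : x 0 = s * 0 + t * (b / 2) := hk 0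
      have k1 : x 1 = s * 0 + t * 0 := hk 1
      have k2 : x 2 = s * 1 + t * ((1 - a) / 2) := hk 2
      apply fin
      · rw [k2]; nlinarith
      · rw [k1]; ring
      · intro h
        have ht0 : t = 0 := by
          have : t * b = 0 := by linarith
          exact (mul_eq_zero.1 this).resolve_right hb.ne'
        rw [k2, ht0]; linarith
    · obtain ⟨s, t, hs, ht, hst, hk⟩ := seg_coord hx
      have k0 : x 0 = s * 0 + t * (-b / 2) := hk 0
      have k1 : x 1 = s * 0 + t * 0 := hk 1
      have k2 : x 2 = s * 1 + t * ((1 - a) / 2) := hk 2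
      apply fin
      · rw [k2]; nlinarith
      · rw [k1]; ring
      · intro h
        have ht0 : t = 0 := by
          have : t * b = 0 := by linarith
          exact (mul_eq_zero.1 this).resolve_right hb.ne'
        rw [k2, ht0]; linarith
  -- the section
  have hne : H.Nonempty := ⟨_, h2 _ (subset_skel _ htop)⟩
  have : ContractibleSpace H := hH.contractibleSpace hne
  have : LocallyPathConnectedSpace H := hH.locallyPathConnectedSpace
  let φ : H → Pt := fun y => h.symm y
  have hφi : Topology.IsInducing φ := h.symm.isInducing.comp Topology.IsInducing.subtypeVal
  have hφ : Continuous φ := hφi.continuous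
  obtain ⟨s, hs, hsg⟩ := exists_section (Y := H) (fun i => φ ⁻¹' chart a b i)
    (fun i => (isOpen_chart a b i).preimage hφ)
    (fun y => chart_cover hb hab ha (p := φ y)
      (fun hm => h0 _ hm (by simp [φ])) (fun hm => h1 _ hm (by simp [φ])))
    (fun i y => glue i (φ y))
    (fun i j y hi hj => (hφ.tendsto y).eventually (trans_loc i j hi hj))
  have const : ∀ (i : Fin 3) (J : Set Pt), IsPreconnected J → J ⊆ skel (V2 a b) →
      J ⊆ chart a b i → ∀ y y' : H, φ y ∈ J → φ y' ∈ J → s i y = s i y' := by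
    intro i J hJ hJs hJc y y' hy hy'
    have him : φ '' (φ ⁻¹' J) = J := by
      apply Set.image_preimage_eq_of_subset
      intro x hx
      exact ⟨⟨h x, h2 x (hJs hx)⟩, by simp [φ]⟩
    have hpre : IsPreconnected (φ ⁻¹' J) := by
      rw [← hφi.isPreconnected_image, him]; exact hJ
    exact (hpre.image (s i) ((hs i).mono (Set.preimage_mono hJc))).subsingleton
      (Set.mem_image_of_mem _ hy) (Set.mem_image_of_mem _ hy')
  have lift : ∀ q ∈ skel (V2 a b), ∃ y : H, φ y = q :=
    fun q hq => ⟨⟨h q, h2 q hq⟩, by simp [φ]⟩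
  obtain ⟨yqr, eqr⟩ := lift qr (er hqr)
  obtain ⟨yql, eql⟩ := lift ql (el hql)
  obtain ⟨ypr, epr⟩ := lift pr (subset_skel _ hpr)
  obtain ⟨ypl, epl⟩ := lift pl (subset_skel _ hpl)
  have r1 : s 1 yqr = s 1 ypr := const 1 _ (convex_segment _ _).isPreconnected Jr Cr _ _
    (by rw [eqr]; exact left_mem_segment ℝ _ _) (by rw [epr]; exact right_mem_segment ℝ _ _)
  have r2 : s 1 yql = s 1 ypl := const 1 _ (convex_segment _ _).isPreconnected Jl Cl _ _
    (by rw [eql]; exact left_mem_segment ℝ _ _) (by rw [epl]; exact right_mem_segment ℝ _ _)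
  have r3 : s 2 ypr = s 2 ypl := const 2 _ (convex_segment _ _).isPreconnected eb Cb _ _
    (by rw [epr]; exact left_mem_segment ℝ _ _) (by rw [epl]; exact right_mem_segment ℝ _ _)
  have r4 : s 2 yqr = s 2 yql := const 2 _
    (IsPreconnected.union top (left_mem_segment ℝ _ _) (left_mem_segment ℝ _ _)
      (convex_segment _ _).isPreconnected (convex_segment _ _).isPreconnected) Jt Ct _ _
    (by rw [eqr]; exact Or.inl (right_mem_segment ℝ _ _))
    (by rw [eql]; exact Or.inr (right_mem_segment ℝ _ _))
  have g1 := hsg 1 2 yqr (by show φ yqr ∈ chart a b 1; rw [eqr]; exact Cr (left_mem_segment ℝ _ _))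
    (by show φ yqr ∈ chart a b 2; rw [eqr]; exact Ct (Or.inl (right_mem_segment ℝ _ _)))
  have g2 := hsg 1 2 yql (by show φ yql ∈ chart a b 1; rw [eql]; exact Cl (left_mem_segment ℝ _ _))
    (by show φ yql ∈ chart a b 2; rw [eql]; exact Ct (Or.inr (right_mem_segment ℝ _ _)))
  have g3 := hsg 1 2 ypr (by show φ ypr ∈ chart a b 1; rw [epr]; exact Cr (right_mem_segment ℝ _ _))
    (by show φ ypr ∈ chart a b 2; rw [epr]; exact Cb (left_mem_segment ℝ _ _))
  have g4 := hsg 1 2 ypl (by show φ ypl ∈ chart a b 1; rw [epl]; exact Cl (right_mem_segment ℝ _ _))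
    (by show φ ypl ∈ chart a b 2; rw [epl]; exact Cb (right_mem_segment ℝ _ _))
  have G1 : ∀ q : Pt, glue 1 q = if 0 < q 2 then 1 else Equiv.swap 0 1 := fun q => rfl
  have G2 : ∀ q : Pt, glue 2 q = if 0 < q 0 then 1 else Equiv.swap 1 2 := fun q => rfl
  have a0 : ¬ (0 < -a) := by linarith
  have b0 : ¬ (0 < -b) := by linarith
  have b0' : ¬ (0 < -b / 2) := by linarith
  have b1 : 0 < b / 2 := by linarith
  have a1 : 0 < (1 - a) / 2 := by linarith
  have z1 : qr 0 = b / 2 := rfl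
  have z2 : qr 2 = (1 - a) / 2 := rfl
  have z3 : ql 0 = -b / 2 := rfl
  have z4 : ql 2 = (1 - a) / 2 := rfl
  have z5 : pr 0 = b := rfl
  have z6 : pr 2 = -a := rfl
  have z7 : pl 0 = -b := rfl
  have z8 : pl 2 = -a := rfl
  rw [eqr, G1, G2, z1, z2, if_pos b1, if_pos a1] at g1
  rw [eql, G1, G2, z3, z4, if_neg b0', if_pos a1] at g2
  rw [epr, G1, G2, z5, z6, if_pos hb, if_neg a0] at g3
  rw [epl, G1, G2, z7, z8, if_neg b0, if_neg a0] at g4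
  simp only [mul_one, inv_one, one_mul, Equiv.Perm.one_apply, Equiv.Perm.mul_apply,
    Equiv.swap_inv] at g1 g2 g3 g4
  apply swap_ne (s 1 yql)
  rw [← g2, ← r4, g1, r1, ← g3, r3, g4, r2]

/-- The cyclic coordinate permutation as an affine map. -/
def cycL : Pt →ₗ[ℝ] Pt where
  toFun := cyc
  map_add' x y := by ext i; fin_cases i <;> simp [cyc]
  map_smul' c x := by ext i; fin_cases i <;> simp [cyc]

/-- The cyclic coordinate permutation as a homeomorphism. -/
def cycH : Pt ≃ₜ Pt where
  toFun := cyc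
  invFun := fun v => cyc (cyc v)
  left_inv v := by ext i; fin_cases i <;> simp [cyc]
  right_inv v := by ext i; fin_cases i <;> simp [cyc]
  continuous_toFun := cycL.continuous_of_finiteDimensional
  continuous_invFun := cycL.continuous_of_finiteDimensional.comp
    cycL.continuous_of_finiteDimensional

lemma cyc_skel (V : Set Pt) : cycH '' skel V = skel (cyc '' V) :=
  image_skel cycL.toAffineMap V

lemma cyc_V0 (a b : ℝ) : cyc '' V0 a b = V1 a b := by
  simp [V0, V1, Set.image_insert_eq, cyc]
lemma cyc_V1 (a b : ℝ) : cyc '' V1 a b = V2 a b := by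
  simp [V1, V2, Set.image_insert_eq, cyc]
lemma cyc_V2 (a b : ℝ) : cyc '' V2 a b = V0 a b := by
  simp [V2, V0, Set.image_insert_eq, cyc]

lemma disj01 {a b : ℝ} (hb : 0 < b) (hab : b < a) (ha : a < 1) :
    Disjoint (skel (V0 a b)) (skel (V1 a b)) := by
  rw [Set.disjoint_left]
  intro x hx hx'
  have hx1 : x 2 = 0 ∧ (1 + a) * x 1 ≤ b * (1 - x 0) ∧ -(1 + a) * x 1 ≤ b * (1 - x 0) := by
    have hc : Convex ℝ {x : Pt | x 2 = 0 ∧ (1 + a) * x 1 ≤ b * (1 - x 0) ∧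
        -(1 + a) * x 1 ≤ b * (1 - x 0)} := by
      rintro p ⟨p1, p2, p3⟩ q ⟨q1, q2, q3⟩ s t hs ht hst
      have hs' : s = 1 - t := by linarith
      refine ⟨?_, ?_, ?_⟩
      · simp [p1, q1]
      · simp only [Pi.add_apply, Pi.smul_apply, smul_eq_mul]
        have := add_le_add (mul_le_mul_of_nonneg_left p2 hs) (mul_le_mul_of_nonneg_left q2 ht)
        subst hs'; linarith
      · simp only [Pi.add_apply, Pi.smul_apply, smul_eq_mul]
        have := add_le_add (mul_le_mul_of_nonneg_left p3 hs) (mul_le_mul_of_nonneg_left q3 ht)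
        subst hs'; linarith
    refine skel_subset_of_convex hc ?_ hx
    rintro p (rfl | rfl | rfl)
    · simp
    · refine ⟨by simp, ?_, ?_⟩ <;> simp <;> nlinarith
    · refine ⟨by simp, ?_, ?_⟩ <;> simp <;> nlinarith
  obtain ⟨x2, u1, u2⟩ := hx1
  obtain ⟨p, hp, q, hq, hseg⟩ := mem_skel.1 hx'
  obtain ⟨s, t, hs, ht, hst, hk⟩ := seg_coord hseg
  have k0 := hk 0
  have k1 := hk 1
  have k2 := hk 2
  rw [x2] at k2
  have x0 : x 0 = 0 := by
    rw [k0]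
    rcases hp with rfl | rfl | rfl <;> rcases hq with rfl | rfl | rfl <;> simp
  have x1 : x 1 = 1 ∨ x 1 = -a := by
    rw [k1]
    rcases hp with rfl | rfl | rfl <;> rcases hq with rfl | rfl | rfl <;>
      simp [hb.ne'] at k2 ⊢
    · left; exact hst
    · left; rw [k2] at hst ⊢; linarith
    · left; rw [k2] at hst ⊢; linarith
    · left; rw [k2] at hst ⊢; linarith
    · right; linear_combination (-a) * hst
    · right; linear_combination (-a) * hst
    · left; rw [k2] at hst ⊢; linarith
    · right; linear_combination (-a) * hst
    · right; linear_combination (-a) * hst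
  rw [x0] at u1 u2
  rcases x1 with x1 | x1 <;> rw [x1] at u1 u2 <;> nlinarith

lemma valknut_sets (T : Fin 3 → Tri) (hV : IsValknut T) : ∃ a b : ℝ, 0 < b ∧ b < a ∧ a < 1 ∧
    (T 0).outline = skel (V0 a b) ∧ (T 1).outline = skel (V1 a b) ∧
    (T 2).outline = skel (V2 a b) := by
  obtain ⟨e0, e1, e2⟩ := hV
  refine ⟨2 / Real.sqrt 5, 1 / Real.sqrt 10, by positivity, ?_, ?_, ?_, ?_, ?_⟩
  · have h5 : Real.sqrt 5 ≤ Real.sqrt 10 := Real.sqrt_le_sqrt (by norm_num)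
    have : 1 / Real.sqrt 10 ≤ 1 / Real.sqrt 5 := one_div_le_one_div_of_le (by positivity) h5
    have h6 : 0 < 1 / Real.sqrt 5 := by positivity
    have h7 : 2 / Real.sqrt 5 = 2 * (1 / Real.sqrt 5) := by ring
    linarith
  · rw [div_lt_one (by positivity)]
    exact Real.lt_sqrt_of_sq_lt (by norm_num)
  · rw [outline_eq_skel, e0]; congr 1
    simp only [w₁, w₂, w₃, V0, neg_div]
  · rw [outline_eq_skel, e1]; congr 1
    simp [w₁, w₂, w₃, V1, cyc, neg_div]
  · rw [outline_eq_skel, e2]; congr 1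
    simp [w₁, w₂, w₃, V2, cyc, neg_div]

/-- The Valknut linking is not combinatorially isotopic (for any ordering) to a Hopf linking
of two triangles together with a third triangle whose convex hull is disjoint from the
outlines of the first two. -/
theorem stmt8 (T : Fin 3 → Tri) (hV : IsValknut T)
    (T' : Fin 3 → Tri) (hT' : IsLinking T')
    (hHopf : ∃ p : Pt, (T' 0).hull ∩ (T' 1).outline = {p})
    (hthird : Disjoint (T' 2).hull ((T' 0).outline ∪ (T' 1).outline))
    (e : Equiv.Perm (Fin 3)) :
    ¬ CombIsotopic T (T' ∘ ⇑e) := by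
  intro hiso
  obtain ⟨a, b, hb, hab, ha, s0, s1, s2⟩ := valknut_sets T hV
  have d01 := disj01 hb hab ha
  have c0 : cycH '' skel (V0 a b) = skel (V1 a b) := by rw [cyc_skel, cyc_V0]
  have c1 : cycH '' skel (V1 a b) = skel (V2 a b) := by rw [cyc_skel, cyc_V1]
  have c2 : cycH '' skel (V2 a b) = skel (V0 a b) := by rw [cyc_skel, cyc_V2]
  have d12 : Disjoint (skel (V1 a b)) (skel (V2 a b)) := by
    rw [← c0, ← c1]; exact (Set.disjoint_image_iff cycH.injective).2 d01
  have d20 : Disjoint (skel (V2 a b)) (skel (V0 a b)) := by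
    rw [← c1, ← c2]; exact (Set.disjoint_image_iff cycH.injective).2 d12
  have hlink : IsLinking T := by
    intro i j hij
    fin_cases i <;> fin_cases j <;>
      simp only [Fin.zero_eta, Fin.mk_one, Fin.reduceFinMk, s0, s1, s2] at hij ⊢
    · exact absurd rfl hij
    · exact d01
    · exact d20.symm
    · exact d01.symm
    · exact absurd rfl hij
    · exact d12
    · exact d20
    · exact d12.symm
    · exact absurd rfl hij
  obtain ⟨-, h, hh⟩ := isotopic_homeo hlink hiso
  have hconv : Convex ℝ (T' 2).hull := convex_convexHull ℝ _
  have hin : ∀ i, e i = 2 → ∀ p ∈ (T i).outline, h p ∈ (T' 2).hull := by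
    intro i hi p hp
    have : h p ∈ (T' (e i)).outline := by
      have := hh i
      simp only [Function.comp] at this
      rw [← this]; exact Set.mem_image_of_mem _ hp
    rw [hi, outline_eq_skel] at this
    exact skel_subset_of_convex hconv (subset_convexHull ℝ _) this
  have hout : ∀ i, e i ≠ 2 → ∀ p ∈ (T i).outline, h p ∉ (T' 2).hull := by
    intro i hi p hp hm
    have : h p ∈ (T' (e i)).outline := by
      have := hh i
      simp only [Function.comp] at this
      rw [← this]; exact Set.mem_image_of_mem _ hp
    apply Set.disjoint_left.1 hthird hm
    have h3 : ∀ k : Fin 3, k ≠ 2 → k = 0 ∨ k = 1 := by decide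
    rcases h3 _ hi with h4 | h4 <;> rw [h4] at this
    · exact Or.inl this
    · exact Or.inr this
  have hne : ∀ i j, e i = 2 → j ≠ i → e j ≠ 2 := fun i j hi hj hj' =>
    hj (e.injective (hj'.trans hi.symm))
  have m0 : ∀ p ∈ skel (V0 a b), cycH p ∈ skel (V1 a b) := fun p hp => c0 ▸ ⟨p, hp, rfl⟩
  have m1 : ∀ p ∈ skel (V1 a b), cycH p ∈ skel (V2 a b) := fun p hp => c1 ▸ ⟨p, hp, rfl⟩
  have m2 : ∀ p ∈ skel (V2 a b), cycH p ∈ skel (V0 a b) := fun p hp => c2 ▸ ⟨p, hp, rfl⟩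
  obtain ⟨i, hi⟩ := e.surjective 2
  have hcase : ∀ k : Fin 3, k = 0 ∨ k = 1 ∨ k = 2 := by decide
  rcases hcase i with rfl | rfl | rfl
  · have n1 := hout 1 (hne 0 1 hi (by decide))
    have n2 := hout 2 (hne 0 2 hi (by decide))
    have n0 := hin 0 hi
    rw [s0] at n0; rw [s1] at n1; rw [s2] at n2
    exact core hb hab ha (cycH.trans h) hconv (fun p hp => n0 _ (m2 p hp))
      (fun p hp => n1 _ (m0 p hp)) (fun p hp => n2 _ (m1 p hp))
  · have n0 := hout 0 (hne 1 0 hi (by decide))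
    have n2 := hout 2 (hne 1 2 hi (by decide))
    have n1 := hin 1 hi
    rw [s0] at n0; rw [s1] at n1; rw [s2] at n2
    exact core hb hab ha (cycH.trans (cycH.trans h)) hconv
      (fun p hp => n1 _ (m0 _ (m2 p hp)))
      (fun p hp => n2 _ (m1 _ (m0 p hp))) (fun p hp => n0 _ (m2 _ (m1 p hp)))
  · have n0 := hout 0 (hne 2 0 hi (by decide))
    have n1 := hout 1 (hne 2 1 hi (by decide))
    have n2 := hin 2 hi
    rw [s0] at n0; rw [s1] at n1; rw [s2] at n2
    exact core hb hab ha h hconv n2 n0 n1
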